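/- arXiv:math/0210171 — 2 statements merged into one kernel-verified Lean document; each statement's English description precedes it below -/
import Mathlib

section
/- Let R = k[X11,...,X23] be the polynomial ring in six variables over a field k and I the ideal generated by the three 2×2 minors f1, f2, f3 of the generic 2×3 matrix. Then the radical of I has height 2, i.e., the quotient R/I has Krull dimension 4. -/
open MvPolynomial

/-- A `2 × 2` minor `X a * X d - X b * X c` in four distinct variables is a prime element. -/
theorem prime_X_mul_X_sub_X_mul_X {σ k : Type*} [Field k] {a b c d : σ}
    (hab : a ≠ b) (hac : a ≠ c) (had : a ≠ d) (hbd : b ≠ d) (hcd : c ≠ d) :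
    Prime (X a * X d - X b * X c : MvPolynomial σ k) := by
  classical
  rw [← UniqueFactorizationMonoid.irreducible_iff_prime, sub_eq_add_neg]
  refine irreducible_mul_X_add (X a) (-(X b * X c)) d (X_ne_zero a) ?_ ?_ ?_
  · simpa using had.symm
  · rw [vars_neg]
    intro h
    have := vars_mul _ _ h
    simp [hbd.symm, hcd.symm] at this
  · refine (X_prime (R := k) (i := a)).irreducible.isRelPrime_iff_not_dvd.mpr ?_
    rintro ⟨q, hq⟩
    have := congrArg (eval fun i => if i = a then (0 : k) else 1) hq
    simp [hab.symm, hac.symm] at this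

/-- If a domain `R` has a prime element `p` and an element `q` not divisible by `p`, then any
quotient of `R` killing both has dimension at most `dim R - 2`. -/
theorem ringKrullDim_quotient_add_two_le {R : Type*} [CommRing R] [IsDomain R] {I : Ideal R}
    {p q : R} (hp : Prime p) (hpq : ¬ p ∣ q) (hpI : p ∈ I) (hqI : q ∈ I) :
    ringKrullDim (R ⧸ I) + 1 + 1 ≤ ringKrullDim R := by
  have : (Ideal.span {p}).IsPrime := (Ideal.span_singleton_prime hp.ne_zero).mpr hp
  have hle : Ideal.span {p} ≤ I := (Ideal.span_singleton_le_iff_mem I).mpr hpI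
  have hq : Ideal.Quotient.mk (Ideal.span {p}) q ≠ 0 := by
    rwa [Ne, Ideal.Quotient.eq_zero_iff_mem, Ideal.mem_span_singleton]
  calc ringKrullDim (R ⧸ I) + 1 + 1 ≤ ringKrullDim (R ⧸ Ideal.span {p}) + 1 := by
        gcongr
        exact ringKrullDim_succ_le_of_surjective (Ideal.Quotient.factor hle)
          (Ideal.Quotient.factor_surjective hle) (mem_nonZeroDivisors_of_ne_zero hq)
          (by simpa [Ideal.Quotient.eq_zero_iff_mem] using hqI)
    _ ≤ ringKrullDim R :=
        ringKrullDim_quotient_succ_le_of_nonZeroDivisor (mem_nonZeroDivisors_of_ne_zero hp.ne_zero)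

/-- The generic parametrization of `2 × 3` matrices of rank at most one: the first row is
`(x₀, x₁, x₂)`, the second row is `y` times the first. -/
noncomputable def rankOneParam (k : Type*) [Field k] :
    MvPolynomial (Fin 2 × Fin 3) k →ₐ[k] MvPolynomial (Option (Fin 3)) k :=
  aeval fun ij => if ij.1 = 0 then X (some ij.2) else X none * X (some ij.2)

/-- The image of `rankOneParam` has dimension at least four. -/
theorem four_le_ringKrullDim_range_rankOneParam (k : Type*) [Field k] :
    4 ≤ ringKrullDim (rankOneParam k).range := by
  let ψ : MvPolynomial (Option (Fin 3)) k →ₐ[k] MvPolynomial (Fin 3) k :=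
    aeval fun i => i.elim 0 X
  let g : (rankOneParam k).range →ₐ[k] MvPolynomial (Fin 3) k := ψ.comp (Subalgebra.val _)
  have hg : Function.Surjective g := by
    intro p
    have hcomp : (ψ.comp (rankOneParam k)).comp (rename (Prod.mk 0)) = AlgHom.id k _ := by
      ext i : 1
      simp [ψ, rankOneParam]
    exact ⟨⟨rankOneParam k (rename (Prod.mk 0) p), _, rfl⟩, DFunLike.congr_fun hcomp p⟩
  let r : (rankOneParam k).range := ⟨rankOneParam k (X (1, 0)), _, rfl⟩
  have hr : r ≠ 0 := by
    intro h
    have := congrArg Subtype.val h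
    simp [r, rankOneParam, X_ne_zero] at this
  have hgr : g r = 0 := by
    change ψ (rankOneParam k (X (1, 0))) = 0
    simp [ψ, rankOneParam]
  have key := ringKrullDim_succ_le_of_surjective g.toRingHom hg
    (mem_nonZeroDivisors_of_ne_zero hr) hgr
  rw [ringKrullDim_of_isNoetherianRing, ringKrullDim_eq_zero_of_field] at key
  refine le_trans (le_of_eq ?_) key
  simp
  norm_num

theorem krullDim_determinantal_quotient (k : Type) [Field k] :
    let X : Fin 2 × Fin 3 → MvPolynomial (Fin 2 × Fin 3) k := MvPolynomial.X
    let f1 := X (0,1) * X (1,2) - X (0,2) * X (1,1)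
    let f2 := X (0,2) * X (1,0) - X (0,0) * X (1,2)
    let f3 := X (0,0) * X (1,1) - X (0,1) * X (1,0)
    let I : Ideal (MvPolynomial (Fin 2 × Fin 3) k) := Ideal.span {f1, f2, f3}
    ringKrullDim (MvPolynomial (Fin 2 × Fin 3) k ⧸ I) = 4 := by
  intro X f1 f2 f3 I
  apply le_antisymm
  · have hp : Prime f3 := prime_X_mul_X_sub_X_mul_X (by decide) (by decide) (by decide)
      (by decide) (by decide)
    have hpq : ¬ f3 ∣ f1 := by
      rintro ⟨q, hq⟩
      have := congrArg (eval fun ij => if ij = (0, 1) ∨ ij = (1, 2) then (1 : k) else 0) hq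
      simp [f1, f3, X] at this
    have key := ringKrullDim_quotient_add_two_le (I := I) hp hpq
      (Ideal.subset_span (by simp)) (Ideal.subset_span (by simp))
    rw [ringKrullDim_of_isNoetherianRing, ringKrullDim_eq_zero_of_field] at key
    have hcard : (0 : WithBot ℕ∞) + (Nat.card (Fin 2 × Fin 3) : ℕ) = 4 + 1 + 1 := by
      simp
      norm_num
    rwa [hcard, ENat.WithBot.add_le_add_one_right_iff, ENat.WithBot.add_le_add_one_right_iff] at key
  · have hI : ∀ p ∈ I, (rankOneParam k).rangeRestrict p = 0 := by
      suffices h : I ≤ RingHom.ker (rankOneParam k).rangeRestrict from fun p hp => h hp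
      refine Ideal.span_le.mpr ?_
      rintro p (rfl | rfl | rfl) <;> refine Subtype.ext ?_ <;>
        simp only [AlgHom.coe_codRestrict, AlgHom.rangeRestrict] <;>
        simp [f1, f2, f3, X, rankOneParam] <;> ring
    exact (four_le_ringKrullDim_range_rankOneParam k).trans <|
      ringKrullDim_le_of_surjective (Ideal.Quotient.lift I _ hI)
        (Ideal.Quotient.lift_surjective_of_surjective _ hI
          (rankOneParam k).rangeRestrict_surjective)
end

section
/- Let R = C[X11,...,X23] and let f1, f2, f3 be the 2×2 minors of the generic 2×3 matrix. Then 1/(f1 f2 f3) is not contained in the sum of the images of R[(f1 f2)^{-1}], R[(f2 f3)^{-1}], and R[(f1 f3)^{-1}] inside R[(f1 f2 f3)^{-1}]. -/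
open MvPolynomial

/-- The natural map `R[a⁻¹] → R[b⁻¹]` when `a ∣ b`. -/
noncomputable def locMap {R : Type} [CommRing R] (a b : R) (h : a ∣ b) :
    Localization.Away a →+* Localization.Away b :=
  Localization.awayLift (algebraMap R (Localization.Away b)) a (by
    obtain ⟨c, rfl⟩ := h
    have hu : IsUnit (algebraMap R (Localization.Away (a * c)) (a * c)) :=
      IsLocalization.map_units (M := Submonoid.powers (a * c)) _
        ⟨a * c, Submonoid.mem_powers _⟩
    rw [map_mul] at hu
    exact isUnit_of_mul_isUnit_left hu)

namespace MinorsOfGenericMatrix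

/-- The apolarity pairing on polynomials: `∑ₘ m! · coeffₘ g · coeffₘ h`. -/
noncomputable def apolar {σ : Type*} :
    MvPolynomial σ ℂ →ₗ[ℂ] MvPolynomial σ ℂ →ₗ[ℂ] ℂ :=
  (basisMonomials σ ℂ).constr ℂ fun m =>
    (m.prod fun _ n => (n.factorial : ℂ)) • lcoeff ℂ m

theorem apolar_monomial {σ : Type*} (m : σ →₀ ℕ) (h : MvPolynomial σ ℂ) :
    apolar (monomial m 1) h = (m.prod fun _ n => (n.factorial : ℂ)) * coeff m h := by
  have := (basisMonomials σ ℂ).constr_basis ℂ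
    (fun m => (m.prod fun _ n => (n.factorial : ℂ)) • lcoeff ℂ m) m
  rw [coe_basisMonomials] at this
  rw [apolar, this]
  simp [lcoeff]

theorem apolar_one_one {σ : Type*} : apolar (1 : MvPolynomial σ ℂ) 1 = 1 := by
  have := apolar_monomial (0 : σ →₀ ℕ) 1
  simpa using this

theorem prod_factorial_add_single {σ : Type*} (i : σ) (m : σ →₀ ℕ) :
    ((m + Finsupp.single i 1).prod fun _ n => (n.factorial : ℂ)) =
      (m i + 1) * m.prod fun _ n => (n.factorial : ℂ) := by
  classical
  have h1 := Finsupp.mul_prod_erase' (m + Finsupp.single i 1) i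
    (fun _ n => (n.factorial : ℂ)) (by simp)
  have h2 := Finsupp.mul_prod_erase' m i (fun _ n => (n.factorial : ℂ)) (by simp)
  rw [← h1, ← h2]
  simp [Finsupp.erase_add, Nat.factorial_succ, mul_assoc]

theorem apolar_X_mul {σ : Type*} (i : σ) (g h : MvPolynomial σ ℂ) :
    apolar (X i * g) h = apolar g (pderiv i h) := by
  suffices H : apolar ∘ₗ LinearMap.mulLeft ℂ (X i) =
      apolar.compl₂ (pderiv i : Derivation ℂ (MvPolynomial σ ℂ) _).toLinearMap by
    exact LinearMap.congr_fun (LinearMap.congr_fun H g) h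
  refine (basisMonomials σ ℂ).ext fun m => LinearMap.ext fun h => ?_
  have hX : (X i * monomial m 1 : MvPolynomial σ ℂ) = monomial (m + Finsupp.single i 1) 1 := by
    rw [X, monomial_mul, one_mul, add_comm]
  simp only [coe_basisMonomials, LinearMap.comp_apply, LinearMap.mulLeft_apply,
    LinearMap.compl₂_apply, hX, apolar_monomial, Derivation.coeFn_coe, coeff_pderiv,
    prod_factorial_add_single]
  ring

/-- The minor of the generic `2 × 3` matrix on the columns `j`, `k`. -/
noncomputable def minor (j k : Fin 3) : MvPolynomial (Fin 2 × Fin 3) ℂ :=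
  X (0, j) * X (1, k) - X (0, k) * X (1, j)

/-- The differential operator obtained from `minor j k` by replacing variables with partials. -/
noncomputable def minorDeriv (j k : Fin 3) (h : MvPolynomial (Fin 2 × Fin 3) ℂ) :
    MvPolynomial (Fin 2 × Fin 3) ℂ :=
  pderiv (1, k) (pderiv (0, j) h) - pderiv (1, j) (pderiv (0, k) h)

theorem apolar_minor_mul (j k : Fin 3) (g h : MvPolynomial (Fin 2 × Fin 3) ℂ) :
    apolar (minor j k * g) h = apolar g (minorDeriv j k h) := by
  rw [minor, minorDeriv, sub_mul, map_sub, LinearMap.sub_apply, mul_assoc, mul_assoc,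
    apolar_X_mul, apolar_X_mul, apolar_X_mul, apolar_X_mul, map_sub]

theorem derivation_pow {σ : Type*} (d : Derivation ℂ (MvPolynomial σ ℂ) (MvPolynomial σ ℂ))
    (f : MvPolynomial σ ℂ) (n : ℕ) : d (f ^ n) = n * f ^ (n - 1) * d f := by
  rw [Derivation.leibniz_pow]
  simp [mul_assoc]

/-- A Cayley-type identity for the minors. -/
theorem minorDeriv_pow {i j k : Fin 3} (hij : i ≠ j) (hjk : j ≠ k) (hik : i ≠ k) (a b c : ℕ) :
    minorDeriv j k (minor j k ^ a * minor k i ^ b * minor i j ^ c) =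
      ((a * (a + b + c + 1) : ℕ) : ℂ) •
        (minor j k ^ (a - 1) * minor k i ^ b * minor i j ^ c) := by
  have key : ∀ (f : MvPolynomial (Fin 2 × Fin 3) ℂ) (n : ℕ),
      f * (n * f ^ (n - 1)) = n * f ^ n := by
    rintro f (_ | n)
    · simp
    · rw [Nat.add_sub_cancel]; ring
  have key₂ : ∀ (f : MvPolynomial (Fin 2 × Fin 3) ℂ) (n : ℕ),
      f * (n * ((n - 1 : ℕ) * f ^ (n - 1 - 1))) = (n - 1) * (n * f ^ (n - 1)) := by
    rintro f (_ | n)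
    · simp
    · rw [Nat.add_sub_cancel, mul_left_comm, key]; push_cast; ring
  have ea₂ := key₂ (minor j k) a
  have eb := key (minor k i) b
  have ec := key (minor i j) c
  simp only [minorDeriv, Derivation.leibniz, derivation_pow, map_add, Derivation.map_natCast,
    smul_eq_mul]
  have hd : ∀ (s t : Fin 2) (p q : Fin 3), pderiv (s, p) (X (t, q) : MvPolynomial (Fin 2 × Fin 3) ℂ)
      = if s = t ∧ p = q then 1 else 0 := by
    intro s t p q
    rw [pderiv_X]
    simp [Pi.single_apply, eq_comm]
  have hm : ∀ (s : Fin 2) (r p q : Fin 3), pderiv (s, r) (minor p q) =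
      (if s = 0 ∧ r = p then X (1, q) else 0) + (if s = 1 ∧ r = q then X (0, p) else 0)
      - (if s = 0 ∧ r = q then X (1, p) else 0) - (if s = 1 ∧ r = p then X (0, q) else 0) := by
    intro s r p q
    simp only [minor, map_sub, Derivation.leibniz, hd, smul_eq_mul]
    split_ifs <;> ring
  simp only [hm, map_sub, map_add, hij.symm, hjk, hjk.symm, hik.symm, and_true, and_false,
    if_true, if_false, zero_ne_one, one_ne_zero, map_zero, hd]
  rw [smul_eq_C_mul, map_natCast]
  push_cast
  generalize minor j k ^ (a - 1 - 1) = A₂, minor j k ^ (a - 1) = A₁, minor j k ^ a = A,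
    minor k i ^ (b - 1 - 1) = B₂, minor k i ^ (b - 1) = B₁, minor k i ^ b = B,
    minor i j ^ (c - 1 - 1) = C₂, minor i j ^ (c - 1) = C₁, minor i j ^ c = C' at ea₂ eb ec ⊢
  rw [minor] at ea₂ eb ec
  linear_combination B * C' * ea₂ + a * A₁ * C' * eb + a * A₁ * B * ec

theorem apolar_minor_pow_succ {i j k : Fin 3} (hij : i ≠ j) (hjk : j ≠ k) (hik : i ≠ k)
    (a b c : ℕ) (g : MvPolynomial (Fin 2 × Fin 3) ℂ) :
    apolar (minor j k ^ (a + 1) * g) (minor j k ^ a * minor k i ^ b * minor i j ^ c) = 0 := by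
  induction a with
  | zero =>
    rw [zero_add, pow_one, apolar_minor_mul, minorDeriv_pow hij hjk hik]
    simp
  | succ a ih =>
    rw [pow_succ', mul_assoc, apolar_minor_mul, minorDeriv_pow hij hjk hik, map_smul,
      Nat.add_sub_cancel, ih, smul_zero]

theorem exists_apolar_minor_pow {i j k : Fin 3} (hij : i ≠ j) (hjk : j ≠ k) (hik : i ≠ k)
    (a b c : ℕ) : ∃ s : ℂ, s ≠ 0 ∧ ∀ g : MvPolynomial (Fin 2 × Fin 3) ℂ,
      apolar (minor j k ^ a * g) (minor j k ^ a * minor k i ^ b * minor i j ^ c) =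
        s * apolar g (minor k i ^ b * minor i j ^ c) := by
  induction a with
  | zero => exact ⟨1, one_ne_zero, by simp⟩
  | succ a ih =>
    obtain ⟨s, hs, h⟩ := ih
    refine ⟨((a + 1) * (a + 1 + b + c + 1) : ℕ) * s,
      mul_ne_zero (Nat.cast_ne_zero.mpr (by positivity)) hs, fun g => ?_⟩
    rw [pow_succ', mul_assoc, apolar_minor_mul, ← pow_succ', minorDeriv_pow hij hjk hik, map_smul,
      Nat.add_sub_cancel, h, smul_eq_mul, mul_assoc]

theorem prod_minor_pow_ne (n : ℕ) (p q r : MvPolynomial (Fin 2 × Fin 3) ℂ) :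
    (minor 1 2 * minor 2 0 * minor 0 1) ^ n ≠
      minor 1 2 ^ (n + 1) * p + minor 2 0 ^ (n + 1) * q + minor 0 1 ^ (n + 1) * r := by
  intro h
  have h₁ : (0 : Fin 3) ≠ 1 := by decide
  have h₂ : (1 : Fin 3) ≠ 2 := by decide
  have h₃ : (0 : Fin 3) ≠ 2 := by decide
  have hp := apolar_minor_pow_succ h₁ h₂ h₃ n n n p
  have hq := apolar_minor_pow_succ h₂ h₃.symm h₁.symm n n n q
  have hr := apolar_minor_pow_succ h₃.symm h₁ h₂.symm n n n r
  obtain ⟨s, hs, es⟩ := exists_apolar_minor_pow h₁ h₂ h₃ n n n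
  obtain ⟨t, ht, et⟩ := exists_apolar_minor_pow h₂ h₃.symm h₁.symm n n 0
  obtain ⟨u, hu, eu⟩ := exists_apolar_minor_pow h₃.symm h₁ h₂.symm n 0 0
  have e₁ := es (minor 2 0 ^ n * minor 0 1 ^ n)
  have e₂ := et (minor 0 1 ^ n)
  have e₃ := eu 1
  simp only [pow_zero, mul_one, apolar_one_one] at e₁ e₂ e₃
  rw [e₂, e₃, ← mul_assoc, ← mul_pow, ← mul_pow] at e₁
  have hF₁ : minor 1 2 ^ n * minor 2 0 ^ n * minor 0 1 ^ n =
      (minor 1 2 * minor 2 0 * minor 0 1) ^ n := by ring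
  have hF₂ : minor 2 0 ^ n * minor 0 1 ^ n * minor 1 2 ^ n =
      (minor 1 2 * minor 2 0 * minor 0 1) ^ n := by ring
  have hF₃ : minor 0 1 ^ n * minor 1 2 ^ n * minor 2 0 ^ n =
      (minor 1 2 * minor 2 0 * minor 0 1) ^ n := by ring
  rw [hF₁] at hp
  rw [hF₂] at hq
  rw [hF₃] at hr
  have e : apolar ((minor 1 2 * minor 2 0 * minor 0 1) ^ n)
      ((minor 1 2 * minor 2 0 * minor 0 1) ^ n) = 0 := by
    conv_lhs => arg 1; rw [h]
    simp only [map_add, LinearMap.add_apply, hp, hq, hr, add_zero]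
  rw [e] at e₁
  exact mul_ne_zero hs (mul_ne_zero ht hu) e₁.symm

/-- Elements of `R[a⁻¹]` acquire the numerator `cⁿ` and denominator `bⁿ` in `R[b⁻¹]`, `b = ac`. -/
theorem exists_pow_mul_locMap {R : Type} [CommRing R] {a b : R} (c : R) (h : a ∣ b)
    (hc : a * c = b) (x : Localization.Away a) :
    ∃ (n : ℕ) (r : R), ∀ N, n ≤ N → algebraMap R (Localization.Away b) b ^ N * locMap a b h x =
      algebraMap R (Localization.Away b) (c ^ N * r * a ^ (N - n)) := by
  obtain ⟨n, r, hr⟩ := IsLocalization.Away.surj a x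
  refine ⟨n, r, fun N hN => ?_⟩
  have hmap : ∀ y, locMap a b h (algebraMap R _ y) = algebraMap R _ y := fun y =>
    IsLocalization.lift_eq _ y
  have := congrArg (locMap a b h) hr
  rw [map_mul, map_pow, hmap, hmap] at this
  have hb : algebraMap R (Localization.Away b) b =
      algebraMap R _ a * algebraMap R _ c := by rw [← map_mul, hc]
  rw [map_mul, map_mul, ← this, map_pow, map_pow, hb]
  obtain ⟨d, rfl⟩ := Nat.exists_eq_add_of_le hN
  rw [Nat.add_sub_cancel_left]
  ring

theorem exists_pow_eq_of_mk_one_mem {R : Type} [CommRing R] (f1 f2 f3 : R)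
    (h : (Localization.mk 1 ⟨f1 * f2 * f3, Submonoid.mem_powers _⟩ :
        Localization.Away (f1 * f2 * f3)) ∈
      ((locMap (f1 * f2) (f1 * f2 * f3) (Dvd.intro f3 rfl)).toAddMonoidHom.range ⊔
        (locMap (f2 * f3) (f1 * f2 * f3) ⟨f1, by ring⟩).toAddMonoidHom.range ⊔
        (locMap (f1 * f3) (f1 * f2 * f3) ⟨f2, by ring⟩).toAddMonoidHom.range)) :
    ∃ (n : ℕ) (p q r : R), (f1 * f2 * f3) ^ n =
      f1 ^ (n + 1) * p + f2 ^ (n + 1) * q + f3 ^ (n + 1) * r := by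
  obtain ⟨_, hxy, _, ⟨z, rfl⟩, h⟩ := AddSubgroup.mem_sup.mp h
  obtain ⟨_, ⟨x, rfl⟩, _, ⟨y, rfl⟩, rfl⟩ := AddSubgroup.mem_sup.mp hxy
  obtain ⟨l, p, hp⟩ := exists_pow_mul_locMap f3 (Dvd.intro f3 rfl) rfl x
  obtain ⟨m, q, hq⟩ := exists_pow_mul_locMap (b := f1 * f2 * f3) f1 ⟨f1, by ring⟩ (by ring) y
  obtain ⟨n, r, hr⟩ := exists_pow_mul_locMap (b := f1 * f2 * f3) f2 ⟨f2, by ring⟩ (by ring) z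
  set F := f1 * f2 * f3 with hF
  set N := l + m + n
  have hone : algebraMap _ (Localization.Away F) F *
      Localization.mk 1 ⟨F, Submonoid.mem_powers _⟩ = 1 := by
    rw [← Localization.mk_one_eq_algebraMap, Localization.mk_mul, ← Localization.mk_one]
    rw [Localization.mk_eq_mk_iff, Localization.r_iff_exists]
    exact ⟨1, by simp⟩
  have hN := congrArg (algebraMap _ (Localization.Away F) F ^ (N + 1) * ·) h
  simp only [RingHom.toAddMonoidHom_eq_coe, AddMonoidHom.coe_coe] at hN
  rw [pow_succ, mul_assoc _ _ (Localization.mk _ _), hone, mul_one, mul_right_comm, mul_add,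
    mul_add, hp N (by omega), hq N (by omega), hr N (by omega), ← map_add, ← map_add, ← map_mul,
    ← map_pow] at hN
  obtain ⟨⟨_, M, rfl⟩, hM⟩ := (IsLocalization.eq_iff_exists (Submonoid.powers F) _).mp hN
  refine ⟨M + N, (f2 * f3) ^ (M + 1) * q * (f2 * f3) ^ (N - m),
    (f1 * f3) ^ (M + 1) * r * (f1 * f3) ^ (N - n),
    (f1 * f2) ^ (M + 1) * p * (f1 * f2) ^ (N - l), ?_⟩
  simp only at hM
  rw [pow_add F, ← hM, hF]
  ring

end MinorsOfGenericMatrix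

open MinorsOfGenericMatrix in
/-- `1/(f₁f₂f₃)` is not in the sum of the images of `R[(f₁f₂)⁻¹]`, `R[(f₂f₃)⁻¹]` and
`R[(f₁f₃)⁻¹]` inside `R[(f₁f₂f₃)⁻¹]`, for the `2×2` minors of the generic `2×3` matrix
over `ℂ`. -/
theorem one_div_f1f2f3_not_in_sum :
    let X : Fin 2 × Fin 3 → MvPolynomial (Fin 2 × Fin 3) ℂ := MvPolynomial.X
    let f1 := X (0,1) * X (1,2) - X (0,2) * X (1,1)
    let f2 := X (0,2) * X (1,0) - X (0,0) * X (1,2)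
    let f3 := X (0,0) * X (1,1) - X (0,1) * X (1,0)
    (Localization.mk 1 ⟨f1 * f2 * f3, Submonoid.mem_powers _⟩ :
        Localization.Away (f1 * f2 * f3)) ∉
      ((locMap (f1 * f2) (f1 * f2 * f3) (Dvd.intro f3 rfl)).toAddMonoidHom.range ⊔
        (locMap (f2 * f3) (f1 * f2 * f3) ⟨f1, by ring⟩).toAddMonoidHom.range ⊔
        (locMap (f1 * f3) (f1 * f2 * f3) ⟨f2, by ring⟩).toAddMonoidHom.range) := by
  intro X f1 f2 f3 h
  obtain ⟨n, p, q, r, e⟩ := exists_pow_eq_of_mk_one_mem f1 f2 f3 h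
  exact prod_minor_pow_ne n p q r e
end
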